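/- For every k ≥ 3, dim_K(J_p ∩ L_{p,k}) ≤ (p−1) · dim_K(J_p ∩ L_{p,k−1}) + p · C(k+p−4, k−2), and dim_K(J_p ∩ L_{p,2}) ≤ p, where C(·,·) denotes the binomial coefficient. -/

import Mathlib

namespace Paper

variable (K : Type) [Field K] (p : ℕ)

abbrev Idx (p : ℕ) : Type := (ZMod p)ˣ ⊕ (ZMod p)ˣ

/-- The Lie ideal of the free Lie algebra generated by the `v`-generators. -/
noncomputable def vIdealFree : LieIdeal K (FreeLieAlgebra K (Idx p)) :=
  LieSubmodule.lieSpan K _ (Set.range fun i => FreeLieAlgebra.of K (Sum.inr i : Idx p))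

noncomputable def rels : Set (FreeLieAlgebra K (Idx p)) :=
  { z : FreeLieAlgebra K (Idx p) | ∃ i j : (ZMod p)ˣ,
      z = ⁅FreeLieAlgebra.of K (Sum.inl i : Idx p), FreeLieAlgebra.of K (Sum.inl j : Idx p)⁆ } ∪
  { z : FreeLieAlgebra K (Idx p) | ∃ u ∈ vIdealFree K p, ∃ w ∈ vIdealFree K p, z = ⁅u, w⁆ }

noncomputable def relIdeal : LieIdeal K (FreeLieAlgebra K (Idx p)) :=
  LieSubmodule.lieSpan K _ (rels K p)

abbrev Lp : Type := FreeLieAlgebra K (Idx p) ⧸ relIdeal K p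

noncomputable def gen (x : Idx p) : Lp K p :=
  LieSubmodule.Quotient.mk (N := relIdeal K p) (FreeLieAlgebra.of K x)

noncomputable def aGen (i : (ZMod p)ˣ) : Lp K p := gen K p (Sum.inl i)
noncomputable def vGen (i : (ZMod p)ˣ) : Lp K p := gen K p (Sum.inr i)

/-- Left-normed bracket `[x, l₁, l₂, …]` in the generators. -/
noncomputable def lnb (x : Idx p) (l : List (Idx p)) : Lp K p :=
  l.foldl (fun b y => ⁅b, gen K p y⁆) (gen K p x)

/-- Degree-`k` homogeneous component: the span of left-normed brackets of length `k`. -/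
noncomputable def homog (k : ℕ) : Submodule K (Lp K p) :=
  Submodule.span K { z | ∃ x l, l.length + 1 = k ∧ z = lnb K p x l }

/-- Fixed-point subspace of a Lie algebra automorphism. -/
noncomputable def fixedSubmodule (e : Lp K p ≃ₗ⁅K⁆ Lp K p) : Submodule K (Lp K p) where
  carrier := { x | e x = x }
  add_mem' := by
    intro a b ha hb
    simp only [Set.mem_setOf_eq] at *
    rw [show e (a + b) = e a + e b from map_add e.toLinearEquiv a b, ha, hb]
  zero_mem' := by
    simp only [Set.mem_setOf_eq]
    rw [show e 0 = 0 from map_zero e.toLinearEquiv]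
  smul_mem' := by
    intro c a ha
    simp only [Set.mem_setOf_eq] at *
    rw [show e (c • a) = c • e a from map_smul e.toLinearEquiv c a, ha]

/-- Eigenspace of a Lie algebra automorphism for the eigenvalue `c`. -/
noncomputable def eigSp (e : Lp K p ≃ₗ⁅K⁆ Lp K p) (c : K) : Submodule K (Lp K p) where
  carrier := { x | e x = c • x }
  add_mem' := by
    intro a b ha hb
    simp only [Set.mem_setOf_eq] at *
    rw [show e (a + b) = e a + e b from map_add e.toLinearEquiv a b, ha, hb, smul_add]
  zero_mem' := by
    simp only [Set.mem_setOf_eq]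
    rw [show e 0 = 0 from map_zero e.toLinearEquiv, smul_zero]
  smul_mem' := by
    intro d a ha
    simp only [Set.mem_setOf_eq] at *
    rw [show e (d • a) = d • e a from map_smul e.toLinearEquiv d a, ha, smul_comm]


/-- The derived subalgebra of the fixed-point subspace of `h`. -/
noncomputable def derivedFixed (K : Type) [Field K] (p : ℕ) (h : Lp K p ≃ₗ⁅K⁆ Lp K p) :
    LieSubalgebra K (Lp K p) :=
  LieSubalgebra.lieSpan K (Lp K p)
    { z : Lp K p | ∃ x ∈ fixedSubmodule K p h, ∃ y ∈ fixedSubmodule K p h, z = ⁅x, y⁆ }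

/-- `J_p`: the smallest Lie ideal of `L_p` containing `[C_{L_p}(h), C_{L_p}(h)]` and invariant
under both `f` and `h`. -/
noncomputable def Jp (K : Type) [Field K] (p : ℕ) (f h : Lp K p ≃ₗ⁅K⁆ Lp K p) :
    LieIdeal K (Lp K p) :=
  sInf { J : LieIdeal K (Lp K p) |
    (∀ z ∈ derivedFixed K p h, z ∈ J) ∧ (∀ x ∈ J, f x ∈ J) ∧ (∀ x ∈ J, h x ∈ J) }

section LinearAlgebra

open Module

variable {K V : Type*} [Field K] [AddCommGroup V] [Module K V]

theorem finrank_iSup_le_sum {ι : Type*} [Fintype ι] (S : ι → Submodule K V)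
    [∀ i, FiniteDimensional K (S i)] :
    finrank K (⨆ i, S i : Submodule K V) ≤ ∑ i, finrank K (S i) := by
  classical
  have key : ∀ s : Finset ι, finrank K (s.sup S : Submodule K V) ≤ ∑ i ∈ s, finrank K (S i) := by
    intro s
    induction s using Finset.induction_on with
    | empty => simp
    | insert i s hi ih =>
      rw [Finset.sup_insert, Finset.sum_insert hi]
      have : FiniteDimensional K (s.sup S : Submodule K V) :=
        Submodule.finiteDimensional_finset_sup s S
      exact (Submodule.finrank_add_le_finrank_add_finrank _ _).trans (by gcongr)
  rw [← Finset.sup_univ_eq_iSup]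
  exact key Finset.univ

/-- If `W` is generated, modulo the image of `g - 1`, by `n` elements, then the fixed space of `g`
in `W` has dimension at most `n`. -/
theorem finrank_fixed_le_card {ι : Type*} [Fintype ι] (g : V →ₗ[K] V) (W : Submodule K V)
    [FiniteDimensional K W] (w : ι → V)
    (hw : W ≤ W.map (g - LinearMap.id) ⊔ Submodule.span K (Set.range w)) :
    finrank K (W ⊓ LinearMap.ker (g - LinearMap.id) : Submodule K V) ≤ Fintype.card ι := by
  have h1 := ((g - LinearMap.id).domRestrict W).finrank_range_add_finrank_ker
  rw [LinearMap.range_domRestrict] at h1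
  have h2 : finrank K (LinearMap.ker ((g - LinearMap.id).domRestrict W)) =
      finrank K (W ⊓ LinearMap.ker (g - LinearMap.id) : Submodule K V) := by
    have e : (LinearMap.ker ((g - LinearMap.id).domRestrict W)).map W.subtype =
        W ⊓ LinearMap.ker (g - LinearMap.id) := by
      ext x
      simp [and_comm]
    rw [← e, Submodule.finrank_map_subtype_eq]
  have : FiniteDimensional K (Submodule.span K (Set.range w)) :=
    FiniteDimensional.span_of_finite K (Set.finite_range w)
  have h3 := (Submodule.finrank_mono hw).trans
    (Submodule.finrank_add_le_finrank_add_finrank _ _)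
  have h4 := finrank_range_le_card (R := K) w
  rw [Set.finrank] at h4
  omega

end LinearAlgebra

section Monomials

variable {K L ι : Type*} [Field K] [LieRing L] [LieAlgebra K L]

/-- The iterated right bracket `[x, a i₁, a i₂, …]` over the multiset of indices `s`. -/
noncomputable def adMonomial (a : ι → L) (s : Multiset ι) (x : L) : L :=
  s.toList.foldr (fun i y => ⁅y, a i⁆) x

@[simp]
theorem adMonomial_zero (a : ι → L) (x : L) : adMonomial a 0 x = x := by
  simp [adMonomial]

theorem adMonomial_cons {a : ι → L} (ha : ∀ i j, ⁅a i, a j⁆ = 0) (i : ι) (s : Multiset ι) (x : L) :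
    adMonomial a (i ::ₘ s) x = ⁅adMonomial a s x, a i⁆ := by
  have hp : (i ::ₘ s).toList.Perm (i :: s.toList) := by
    rw [← Multiset.coe_eq_coe]
    simp [← Multiset.cons_coe]
  have hc : LeftCommutative (fun (i : ι) (y : L) => ⁅y, a i⁆) := ⟨fun i j y => by
    have h := leibniz_lie y (a i) (a j)
    rw [ha, lie_zero, ← lie_skew] at h
    have h' : ⁅⁅y, a i⁆, a j⁆ - ⁅⁅y, a j⁆, a i⁆ = 0 := by
      rw [sub_eq_add_neg, lie_skew]
      rw [← lie_skew] at h
      simpa [lie_skew] using h.symm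
    exact (sub_eq_zero.mp h').symm⟩
  rw [adMonomial, hp.foldr_eq]
  rfl

/-- The span of the iterated brackets of an element of `v` with `m` elements of `a`. -/
def monomialSpan (K : Type*) {L ι : Type*} [Field K] [LieRing L] [LieAlgebra K L]
    (a v : ι → L) (m : ℕ) : Submodule K L :=
  Submodule.span K (Set.range fun q : Sym ι m × ι => adMonomial a (q.1 : Multiset ι) (v q.2))

theorem adMonomial_mem_monomialSpan (a v : ι → L) (s : Multiset ι) (j : ι) :
    adMonomial a s (v j) ∈ monomialSpan K a v s.card :=
  Submodule.subset_span ⟨(⟨s, rfl⟩, j), rfl⟩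

theorem monomialSpan_le {a v : ι → L} {m : ℕ} {P : Submodule K L}
    (h : ∀ (s : Multiset ι) (j : ι), s.card = m → adMonomial a s (v j) ∈ P) :
    monomialSpan K a v m ≤ P := by
  rw [monomialSpan, Submodule.span_le]
  rintro _ ⟨⟨s, j⟩, rfl⟩
  exact h s j s.2

instance [Finite ι] (a v : ι → L) (m : ℕ) : FiniteDimensional K (monomialSpan K a v m) := by
  classical
  have := Fintype.ofFinite ι
  exact FiniteDimensional.span_of_finite K (Set.finite_range _)

/-- Right multiplication `x ↦ [x, y]`. -/
def bracketRight (K : Type*) {L : Type*} [Field K] [LieRing L] [LieAlgebra K L] (y : L) :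
    L →ₗ[K] L where
  toFun x := ⁅x, y⁆
  map_add' := by simp
  map_smul' := by simp

@[simp]
theorem bracketRight_apply (x y : L) : bracketRight K y x = ⁅x, y⁆ := rfl

theorem lie_mem_monomialSpan {a : ι → L} (ha : ∀ i j, ⁅a i, a j⁆ = 0) (v : ι → L) {m : ℕ} {x y : L}
    (hx : x ∈ monomialSpan K a v m) (hy : y ∈ Submodule.span K (Set.range a)) :
    ⁅x, y⁆ ∈ monomialSpan K a v (m + 1) := by
  induction hy using Submodule.span_induction with
  | mem y hy =>
    obtain ⟨i, rfl⟩ := hy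
    refine monomialSpan_le (P := (monomialSpan K a v (m + 1)).comap (bracketRight K (a i))) ?_ hx
    rintro s j rfl
    rw [Submodule.mem_comap, bracketRight_apply, ← adMonomial_cons ha]
    simpa using adMonomial_mem_monomialSpan (K := K) a v (i ::ₘ s) j
  | zero => simp
  | add y z _ _ hy hz => rw [lie_add]; exact add_mem hy hz
  | smul c y _ hy => rw [lie_smul]; exact Submodule.smul_mem _ _ hy

theorem lie_eq_zero_of_mem_iSup {a v : ι → L}
    (hv : ∀ s i t j, ⁅adMonomial a s (v i), adMonomial a t (v j)⁆ = 0) {x y : L}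
    (hx : x ∈ ⨆ m, monomialSpan K a v m) (hy : y ∈ ⨆ m, monomialSpan K a v m) : ⁅x, y⁆ = 0 := by
  have h1 : ∀ s i, ⁅x, adMonomial a s (v i)⁆ = 0 := by
    intro s i
    refine (iSup_le fun m => monomialSpan_le
      (P := LinearMap.ker (bracketRight K (adMonomial a s (v i)))) ?_) hx
    intro t j _
    simpa using hv t j s i
  refine (iSup_le fun m => monomialSpan_le (P := LinearMap.ker (LieAlgebra.ad K L x)) ?_) hy
  intro t j _
  simpa using h1 t j

theorem lie_eq_zero_of_mem_span {a : ι → L} (ha : ∀ i j, ⁅a i, a j⁆ = 0) {x y : L}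
    (hx : x ∈ Submodule.span K (Set.range a)) (hy : y ∈ Submodule.span K (Set.range a)) :
    ⁅x, y⁆ = 0 := by
  have h1 : ∀ i, ⁅x, a i⁆ = 0 := by
    intro i
    refine (Submodule.span_le (p := LinearMap.ker (bracketRight K (a i)))).mpr ?_ hx
    rintro _ ⟨j, rfl⟩
    simpa using ha j i
  refine (Submodule.span_le (p := LinearMap.ker (LieAlgebra.ad K L x))).mpr ?_ hy
  rintro _ ⟨j, rfl⟩
  simpa using h1 j

theorem span_sup_iSup_monomialSpan_eq_top {a v : ι → L} (ha : ∀ i j, ⁅a i, a j⁆ = 0)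
    (hv : ∀ s i t j, ⁅adMonomial a s (v i), adMonomial a t (v j)⁆ = 0)
    (hgen : ∀ S : LieSubalgebra K L, (∀ i, a i ∈ S) → (∀ i, v i ∈ S) → ∀ x, x ∈ S) :
    Submodule.span K (Set.range a) ⊔ ⨆ m, monomialSpan K a v m = ⊤ := by
  have hU : ∀ x ∈ ⨆ m, monomialSpan K a v m, ∀ y ∈ Submodule.span K (Set.range a),
      ⁅x, y⁆ ∈ ⨆ m, monomialSpan K a v m := by
    intro x hx y hy
    exact (iSup_le fun m z hz => Submodule.mem_iSup_of_mem (m + 1)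
      (lie_mem_monomialSpan ha v hz hy) : ⨆ m, monomialSpan K a v m ≤
        (⨆ m, monomialSpan K a v m).comap (bracketRight K y)) hx
  let S : LieSubalgebra K L :=
    { (Submodule.span K (Set.range a) ⊔ ⨆ m, monomialSpan K a v m : Submodule K L) with
      lie_mem' := by
        intro x y hx hy
        obtain ⟨x₁, hx₁, x₂, hx₂, rfl⟩ := Submodule.mem_sup.mp hx
        obtain ⟨y₁, hy₁, y₂, hy₂, rfl⟩ := Submodule.mem_sup.mp hy
        rw [add_lie, lie_add, lie_add, lie_eq_zero_of_mem_span ha hx₁ hy₁,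
          lie_eq_zero_of_mem_iSup hv hx₂ hy₂, zero_add, add_zero, ← lie_skew]
        exact Submodule.mem_sup_right (add_mem (neg_mem (hU _ hy₂ _ hx₁)) (hU _ hx₂ _ hy₁)) }
  rw [eq_top_iff]
  intro x _
  refine hgen S (fun i => Submodule.mem_sup_left (Submodule.subset_span ⟨i, rfl⟩))
    (fun i => Submodule.mem_sup_right (Submodule.mem_iSup_of_mem 0 ?_)) x
  simpa using adMonomial_mem_monomialSpan (K := K) a v 0 i

/-- `L` is the graded sum of an abelian subalgebra spanned by `a` and of the abelian ideal generated
by `v`; the maps `proj` are the projections, in degree `1` onto the span of `a` and in degree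
`m + 2` onto the brackets of an element of `v` with `m` elements of `a`. -/
structure IsGradedMetabelian (K : Type*) {L ι : Type*} [Field K] [LieRing L] [LieAlgebra K L]
    (a v : ι → L) (proj : ℕ → L →ₗ[K] L) : Prop where
  lie_a : ∀ i j, ⁅a i, a j⁆ = 0
  lie_monomial : ∀ s i t j, ⁅adMonomial a s (v i), adMonomial a t (v j)⁆ = 0
  sup_eq_top : Submodule.span K (Set.range a) ⊔ ⨆ m, monomialSpan K a v m = ⊤
  proj_a : ∀ n i, proj n (a i) = if n = 1 then a i else 0
  proj_monomial : ∀ n s i,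
    proj n (adMonomial a s (v i)) = if n = s.card + 2 then adMonomial a s (v i) else 0

namespace IsGradedMetabelian

variable {a v : ι → L} {proj : ℕ → L →ₗ[K] L}

theorem proj_of_mem_span (H : IsGradedMetabelian K a v proj) (n : ℕ) {x : L}
    (hx : x ∈ Submodule.span K (Set.range a)) : proj n x = if n = 1 then x else 0 := by
  induction hx using Submodule.span_induction with
  | mem y hy =>
    obtain ⟨i, rfl⟩ := hy
    exact H.proj_a n i
  | zero => simp
  | add y z _ _ hy hz => rw [map_add, hy, hz]; split_ifs <;> simp
  | smul c y _ hy => rw [map_smul, hy]; split_ifs <;> simp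

theorem proj_of_mem_monomialSpan (H : IsGradedMetabelian K a v proj) (n : ℕ) {m : ℕ} {x : L}
    (hx : x ∈ monomialSpan K a v m) : proj n x = if n = m + 2 then x else 0 := by
  have key : monomialSpan K a v m ≤
      LinearMap.ker (proj n - if n = m + 2 then LinearMap.id else 0) := by
    refine monomialSpan_le ?_
    rintro s i rfl
    rw [LinearMap.mem_ker, LinearMap.sub_apply, H.proj_monomial]
    split_ifs <;> simp
  have := key hx
  rw [LinearMap.mem_ker, LinearMap.sub_apply, sub_eq_zero] at this
  rw [this]
  split_ifs <;> simp

theorem linearMap_ext (H : IsGradedMetabelian K a v proj) {F G : L →ₗ[K] L}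
    (h1 : ∀ i, F (a i) = G (a i))
    (h2 : ∀ s i, F (adMonomial a s (v i)) = G (adMonomial a s (v i))) : F = G := by
  rw [← sub_eq_zero, ← LinearMap.ker_eq_top, ← top_le_iff, ← H.sup_eq_top, sup_le_iff]
  refine ⟨Submodule.span_le.mpr ?_, iSup_le fun m => monomialSpan_le ?_⟩
  · rintro _ ⟨i, rfl⟩
    simp [h1]
  · intro s i _
    simp [h2]

theorem proj_one_mem (H : IsGradedMetabelian K a v proj) (x : L) :
    proj 1 x ∈ Submodule.span K (Set.range a) ∧
      x - proj 1 x ∈ ⨆ m, monomialSpan K a v m := by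
  have hx : x ∈ Submodule.span K (Set.range a) ⊔ ⨆ m, monomialSpan K a v m :=
    H.sup_eq_top ▸ Submodule.mem_top
  obtain ⟨y, hy, z, hz, rfl⟩ := Submodule.mem_sup.mp hx
  have hz0 : proj 1 z = 0 := by
    refine (iSup_le fun m => ?_ : ⨆ m, monomialSpan K a v m ≤ LinearMap.ker (proj 1)) hz
    intro w hw
    simp [H.proj_of_mem_monomialSpan 1 hw]
  have : proj 1 (y + z) = y := by simp [hz0, H.proj_of_mem_span 1 hy]
  rw [this]
  exact ⟨hy, by simpa using hz⟩

end IsGradedMetabelian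

end Monomials

section Automorphisms

open Module

variable {K L : Type*} [Field K] [LieRing L] [LieAlgebra K L] {p : ℕ}

theorem pow_linearMap_lie (f : L →ₗ⁅K⁆ L) (n : ℕ) (x y : L) :
    ((f : L →ₗ[K] L) ^ n) ⁅x, y⁆ = ⁅((f : L →ₗ[K] L) ^ n) x, ((f : L →ₗ[K] L) ^ n) y⁆ := by
  induction n with
  | zero => simp
  | succ n ih => simp [pow_succ', ih]

theorem pow_linearMap_eq_smul {V : Type*} [AddCommGroup V] [Module K V] {f : V →ₗ[K] V} {c : K}
    {x : V} (hx : f x = c • x) (n : ℕ) : (f ^ n) x = c ^ n • x := by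
  induction n with
  | zero => simp
  | succ n ih => simp [pow_succ', ih, hx, smul_smul, mul_comm]

/-- The action of the two automorphisms on the generators: `f` scales the generators of index `i`
by `ω ^ i`, and `h` multiplies the indices by the generator `r` of `(ZMod p)ˣ`. -/
structure IsFrobeniusPair (ω : K) (r : (ZMod p)ˣ) (a v : (ZMod p)ˣ → L) (f h : L →ₗ⁅K⁆ L) :
    Prop where
  pow_eq_one : ω ^ p = 1
  zpowers_eq_top : Subgroup.zpowers r = ⊤
  f_a : ∀ i, f (a i) = ω ^ (i : ZMod p).val • a i
  f_v : ∀ i, f (v i) = ω ^ (i : ZMod p).val • v i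
  h_a : ∀ i, h (a i) = a (r * i)
  h_v : ∀ i, h (v i) = v (r * i)

namespace IsFrobeniusPair

variable {ω : K} {r : (ZMod p)ˣ} {a v : (ZMod p)ˣ → L} {f h : L →ₗ⁅K⁆ L} {proj : ℕ → L →ₗ[K] L}

theorem h_monomial (F : IsFrobeniusPair ω r a v f h) (ha : ∀ i j, ⁅a i, a j⁆ = 0)
    (s : Multiset (ZMod p)ˣ) (j : (ZMod p)ˣ) :
    h (adMonomial a s (v j)) = adMonomial a (s.map (r * ·)) (v (r * j)) := by
  induction s using Multiset.induction_on with
  | empty => simp [F.h_v]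
  | cons i s ih =>
    rw [Multiset.map_cons, adMonomial_cons ha, adMonomial_cons ha, LieHom.map_lie, ih, F.h_a]

theorem f_monomial (F : IsFrobeniusPair ω r a v f h) (ha : ∀ i j, ⁅a i, a j⁆ = 0)
    (s : Multiset (ZMod p)ˣ) (j : (ZMod p)ˣ) :
    ∃ c : K, c ^ p = 1 ∧ f (adMonomial a s (v j)) = c • adMonomial a s (v j) := by
  have hω : ∀ n : ℕ, (ω ^ n) ^ p = 1 := fun n => by
    rw [← pow_mul, mul_comm, pow_mul, F.pow_eq_one, one_pow]
  induction s using Multiset.induction_on with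
  | empty => exact ⟨ω ^ (j : ZMod p).val, hω _, by simp [F.f_v]⟩
  | cons i s ih =>
    obtain ⟨c, hc, hs⟩ := ih
    refine ⟨ω ^ (i : ZMod p).val * c, by rw [mul_pow, hω, hc, one_mul], ?_⟩
    rw [adMonomial_cons ha, LieHom.map_lie, hs, F.f_a, smul_lie, lie_smul, smul_smul, mul_comm]

theorem h_mem_monomialSpan (F : IsFrobeniusPair ω r a v f h) (ha : ∀ i j, ⁅a i, a j⁆ = 0) {m : ℕ}
    {x : L} (hx : x ∈ monomialSpan K a v m) : h x ∈ monomialSpan K a v m := by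
  refine monomialSpan_le (P := (monomialSpan K a v m).comap (h : L →ₗ[K] L)) ?_ hx
  rintro s j rfl
  have := adMonomial_mem_monomialSpan (K := K) a v (s.map (r * ·)) (r * j)
  rw [Multiset.card_map] at this
  simpa [F.h_monomial ha] using this

theorem f_mem_monomialSpan (F : IsFrobeniusPair ω r a v f h) (ha : ∀ i j, ⁅a i, a j⁆ = 0) {m : ℕ}
    {x : L} (hx : x ∈ monomialSpan K a v m) : f x ∈ monomialSpan K a v m := by
  refine monomialSpan_le (P := (monomialSpan K a v m).comap (f : L →ₗ[K] L)) ?_ hx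
  rintro s j rfl
  obtain ⟨c, -, hc⟩ := F.f_monomial ha s j
  simpa [hc] using Submodule.smul_mem _ c (adMonomial_mem_monomialSpan (K := K) a v s j)

theorem f_pow_mem_monomialSpan (F : IsFrobeniusPair ω r a v f h) (ha : ∀ i j, ⁅a i, a j⁆ = 0)
    {m : ℕ} {x : L} (hx : x ∈ monomialSpan K a v m) (n : ℕ) :
    ((f : L →ₗ[K] L) ^ n) x ∈ monomialSpan K a v m := by
  induction n with
  | zero => simpa
  | succ n ih => simpa [pow_succ'] using F.f_mem_monomialSpan ha ih

theorem f_pow_p (F : IsFrobeniusPair ω r a v f h) (ha : ∀ i j, ⁅a i, a j⁆ = 0) {m : ℕ}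
    {x : L} (hx : x ∈ monomialSpan K a v m) : ((f : L →ₗ[K] L) ^ p) x = x := by
  have key : monomialSpan K a v m ≤ LinearMap.ker ((f : L →ₗ[K] L) ^ p - 1) := by
    refine monomialSpan_le ?_
    rintro s j -
    obtain ⟨c, hc, hs⟩ := F.f_monomial ha s j
    have := pow_linearMap_eq_smul (f := (f : L →ₗ[K] L)) hs p
    simp [this, hc]
  simpa [sub_eq_zero] using key hx

theorem h_f_pow [NeZero p] (F : IsFrobeniusPair ω r a v f h) (H : IsGradedMetabelian K a v proj)
    {m n : ℕ}
    (hmn : (m : ZMod p) * r = n) (x : L) :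
    h (((f : L →ₗ[K] L) ^ n) x) = ((f : L →ₗ[K] L) ^ m) (h x) := by
  have hpow : ∀ i : (ZMod p)ˣ, (ω ^ (i : ZMod p).val) ^ n =
      (ω ^ ((r * i : (ZMod p)ˣ) : ZMod p).val) ^ m := by
    intro i
    rw [← pow_mul, ← pow_mul]
    have : (i : ZMod p).val * n ≡ ((r * i : (ZMod p)ˣ) : ZMod p).val * m [MOD p] := by
      rw [← ZMod.natCast_eq_natCast_iff]
      push_cast
      rw [ZMod.natCast_zmod_val, ZMod.natCast_zmod_val, ← hmn]
      ring
    rw [pow_eq_pow_mod _ F.pow_eq_one, this, ← pow_eq_pow_mod _ F.pow_eq_one]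
  have ha : ∀ i, h (((f : L →ₗ[K] L) ^ n) (a i)) = ((f : L →ₗ[K] L) ^ m) (h (a i)) := by
    intro i
    rw [pow_linearMap_eq_smul (f := (f : L →ₗ[K] L)) (F.f_a i), F.h_a,
      pow_linearMap_eq_smul (f := (f : L →ₗ[K] L)) (F.f_a _), map_smul, F.h_a, hpow]
  refine LinearMap.congr_fun (H.linearMap_ext (F := (h : L →ₗ[K] L) ∘ₗ ((f : L →ₗ[K] L) ^ n))
    (G := ((f : L →ₗ[K] L) ^ m) ∘ₗ (h : L →ₗ[K] L)) ha ?_) x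
  intro s i
  simp only [LinearMap.comp_apply, LieHom.coe_toLinearMap]
  induction s using Multiset.induction_on with
  | empty =>
    rw [adMonomial_zero, pow_linearMap_eq_smul (f := (f : L →ₗ[K] L)) (F.f_v i), F.h_v,
      pow_linearMap_eq_smul (f := (f : L →ₗ[K] L)) (F.f_v _), map_smul, F.h_v, hpow]
  | cons j s ih =>
    rw [adMonomial_cons H.lie_a, pow_linearMap_lie, LieHom.map_lie, LieHom.map_lie,
      pow_linearMap_lie, ih, ha]

theorem proj_h (F : IsFrobeniusPair ω r a v f h) (H : IsGradedMetabelian K a v proj) (n : ℕ)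
    (x : L) : proj n (h x) = h (proj n x) := by
  refine LinearMap.congr_fun (H.linearMap_ext (F := proj n ∘ₗ (h : L →ₗ[K] L))
    (G := (h : L →ₗ[K] L) ∘ₗ proj n) ?_ ?_) x
  · intro i
    simp only [LinearMap.comp_apply, LieHom.coe_toLinearMap]
    rw [F.h_a, H.proj_a, H.proj_a]
    split_ifs <;> simp [F.h_a]
  · intro s i
    simp only [LinearMap.comp_apply, LieHom.coe_toLinearMap]
    rw [F.h_monomial H.lie_a, H.proj_monomial, H.proj_monomial, Multiset.card_map]
    split_ifs <;> simp [F.h_monomial H.lie_a]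

/-- Powers of `h` act trivially modulo the image of `h - 1`. -/
theorem pow_sub_mem_map {V : Type*} [AddCommGroup V] [Module K V] {g : V →ₗ[K] V}
    {W : Submodule K V} (hg : ∀ x ∈ W, g x ∈ W) {x : V} (hx : x ∈ W) (n : ℕ) :
    (g ^ n) x ∈ W ∧ (g ^ n) x - x ∈ W.map (g - LinearMap.id) := by
  induction n with
  | zero => simpa
  | succ n ih =>
    have e : (g ^ (n + 1)) x = g ((g ^ n) x) := by simp [pow_succ']
    refine ⟨e ▸ hg _ ih.1, ?_⟩
    have := add_mem (Submodule.mem_map_of_mem (f := g - LinearMap.id) ih.1) ih.2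
    rw [e]
    simpa using this

theorem exists_pow_eq (F : IsFrobeniusPair ω r a v f h) (j : (ZMod p)ˣ) : ∃ n : ℕ, r ^ n = j := by
  have : j ∈ Subgroup.zpowers r := F.zpowers_eq_top ▸ Subgroup.mem_top j
  rwa [← mem_powers_iff_mem_zpowers] at this

theorem h_pow_a (F : IsFrobeniusPair ω r a v f h) (n : ℕ) (i : (ZMod p)ˣ) :
    ((h : L →ₗ[K] L) ^ n) (a i) = a (r ^ n * i) := by
  induction n with
  | zero => simp
  | succ n ih => simp [pow_succ', ih, F.h_a, mul_assoc]

theorem h_pow_monomial (F : IsFrobeniusPair ω r a v f h) (ha : ∀ i j, ⁅a i, a j⁆ = 0) (n : ℕ)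
    (s : Multiset (ZMod p)ˣ) (j : (ZMod p)ˣ) :
    ((h : L →ₗ[K] L) ^ n) (adMonomial a s (v j)) =
      adMonomial a (s.map (r ^ n * ·)) (v (r ^ n * j)) := by
  induction n with
  | zero => simp
  | succ n ih => simp [pow_succ', ih, F.h_monomial ha, mul_assoc]

theorem finrank_fixed_monomialSpan_le (F : IsFrobeniusPair ω r a v f h)
    (ha : ∀ i j, ⁅a i, a j⁆ = 0) (m : ℕ) [Fact p.Prime] :
    finrank K (monomialSpan K a v m ⊓ LinearMap.ker ((h : L →ₗ[K] L) - LinearMap.id) :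
      Submodule K L) ≤ (p - 1 + m - 1).choose m := by
  classical
  rw [← ZMod.card_units p, ← Sym.card_sym_eq_choose]
  refine finrank_fixed_le_card (h : L →ₗ[K] L) (monomialSpan K a v m)
    (fun s : Sym (ZMod p)ˣ m => adMonomial a (s : Multiset (ZMod p)ˣ) (v 1)) (monomialSpan_le ?_)
  rintro s j rfl
  obtain ⟨n, rfl⟩ := F.exists_pow_eq j
  set s' := s.map ((r ^ n)⁻¹ * ·) with hs'
  have e : ((h : L →ₗ[K] L) ^ n) (adMonomial a s' (v 1)) = adMonomial a s (v (r ^ n)) := by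
    rw [F.h_pow_monomial ha, hs', Multiset.map_map]
    simp
  have hc : s'.card = s.card := by simp [hs']
  have h1 := (pow_sub_mem_map (W := monomialSpan K a v s.card) (g := (h : L →ₗ[K] L))
    (fun x hx => F.h_mem_monomialSpan ha hx)
    (hc ▸ adMonomial_mem_monomialSpan (K := K) a v s' 1) n).2
  rw [e] at h1
  rw [← sub_add_cancel (adMonomial a s (v (r ^ n))) (adMonomial a s' (v 1))]
  exact Submodule.add_mem_sup h1 (Submodule.subset_span ⟨⟨s', hc⟩, rfl⟩)

/-- The `h`-fixed part of the span of the `a i` is a line. -/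
theorem exists_fixed_generator (F : IsFrobeniusPair ω r a v f h) :
    ∃ t ∈ Submodule.span K (Set.range a), h t = t ∧
      ∀ x ∈ Submodule.span K (Set.range a), h x = x → ∃ c : K, x = c • t := by
  have hA : ∀ x ∈ Submodule.span K (Set.range a), h x ∈ Submodule.span K (Set.range a) := by
    intro x hx
    refine (Submodule.span_le (p := (Submodule.span K (Set.range a)).comap (h : L →ₗ[K] L))).mpr
      ?_ hx
    rintro _ ⟨i, rfl⟩
    simpa [F.h_a] using Submodule.subset_span (Set.mem_range_self (f := a) (r * i))
  have : FiniteDimensional K (Submodule.span K (Set.range a)) :=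
    FiniteDimensional.span_of_finite K (Set.finite_range a)
  have h1 := finrank_fixed_le_card (h : L →ₗ[K] L) (Submodule.span K (Set.range a))
    (fun _ : Unit => a 1) (by
      rw [Submodule.span_le]
      rintro _ ⟨i, rfl⟩
      obtain ⟨n, rfl⟩ := F.exists_pow_eq i
      have h1 := (pow_sub_mem_map (g := (h : L →ₗ[K] L)) hA
        (Submodule.subset_span ⟨1, rfl⟩) n).2
      rw [F.h_pow_a, mul_one] at h1
      rw [SetLike.mem_coe, ← sub_add_cancel (a (r ^ n)) (a 1)]
      exact Submodule.add_mem_sup h1 (Submodule.subset_span ⟨(), rfl⟩))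
  rw [Fintype.card_unit, finrank_le_one_iff] at h1
  obtain ⟨⟨t, ht⟩, h1⟩ := h1
  rw [Submodule.mem_inf, LinearMap.mem_ker, LinearMap.sub_apply, sub_eq_zero] at ht
  refine ⟨t, ht.1, ht.2, fun x hx hhx => ?_⟩
  obtain ⟨c, hc⟩ := h1 ⟨x, Submodule.mem_inf.mpr ⟨hx, by simp [hhx]⟩⟩
  exact ⟨c, by simpa using (congrArg Subtype.val hc).symm⟩

end IsFrobeniusPair

end Automorphisms

section Recursion

open Module

variable {K L : Type*} [Field K] [LieRing L] [LieAlgebra K L] {p : ℕ}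

/-- The degree `m + 1` part of the ideal generated by `J` and the brackets of `h`-fixed elements,
in terms of the part of `J` one degree below. -/
def recursionStep (p : ℕ) (a v : (ZMod p)ˣ → L) (f h : L →ₗ⁅K⁆ L) (t : L) (J : LieIdeal K L)
    (m : ℕ) : Submodule K L :=
  (⨆ i, (J.toSubmodule ⊓ monomialSpan K a v m).map (bracketRight K (a i))) ⊔
    ⨆ n : Fin p, (((monomialSpan K a v m ⊓ LinearMap.ker ((h : L →ₗ[K] L) - LinearMap.id)).map
      (bracketRight K t)).map ((f : L →ₗ[K] L) ^ (n : ℕ)))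

theorem recursionStep_le {a v : (ZMod p)ˣ → L} {f h : L →ₗ⁅K⁆ L} {t : L} {J : LieIdeal K L}
    {m : ℕ} {P : Submodule K L}
    (h1 : ∀ i, ∀ x ∈ J, x ∈ monomialSpan K a v m → ⁅x, a i⁆ ∈ P)
    (h2 : ∀ n < p, ∀ x ∈ monomialSpan K a v m, h x = x → ((f : L →ₗ[K] L) ^ n) ⁅x, t⁆ ∈ P) :
    recursionStep p a v f h t J m ≤ P := by
  refine sup_le (iSup_le fun i => ?_) (iSup_le fun n => ?_)
  · rintro _ ⟨x, ⟨hx1, hx2⟩, rfl⟩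
    exact h1 i x hx1 hx2
  · rintro _ ⟨_, ⟨x, ⟨hx1, hx2⟩, rfl⟩, rfl⟩
    exact h2 n n.2 x hx1 (by simpa [sub_eq_zero] using hx2)

theorem lie_a_mem_recursionStep {a v : (ZMod p)ˣ → L} (f h : L →ₗ⁅K⁆ L) (t : L) {J : LieIdeal K L}
    {m : ℕ} (i : (ZMod p)ˣ) {x : L} (hx : x ∈ J) (hx' : x ∈ monomialSpan K a v m) :
    ⁅x, a i⁆ ∈ recursionStep p a v f h t J m :=
  Submodule.mem_sup_left (Submodule.mem_iSup_of_mem i ⟨x, ⟨hx, hx'⟩, rfl⟩)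

theorem pow_lie_mem_recursionStep {a v : (ZMod p)ˣ → L} (f : L →ₗ⁅K⁆ L) {h : L →ₗ⁅K⁆ L} (t : L)
    (J : LieIdeal K L) {m n : ℕ} (hn : n < p) {x : L} (hx : x ∈ monomialSpan K a v m)
    (hx' : h x = x) :
    ((f : L →ₗ[K] L) ^ n) ⁅x, t⁆ ∈ recursionStep p a v f h t J m :=
  Submodule.mem_sup_right (Submodule.mem_iSup_of_mem ⟨n, hn⟩
    ⟨_, ⟨x, ⟨hx, by simp [hx']⟩, rfl⟩, rfl⟩)

variable [Fact p.Prime] {ω : K} {r : (ZMod p)ˣ} {a v : (ZMod p)ˣ → L} {f h : L →ₗ⁅K⁆ L}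
  {proj : ℕ → L →ₗ[K] L}

namespace IsFrobeniusPair

theorem finrank_recursionStep_le (F : IsFrobeniusPair ω r a v f h) (ha : ∀ i j, ⁅a i, a j⁆ = 0)
    (t : L) (J : LieIdeal K L) (m : ℕ) :
    finrank K (recursionStep p a v f h t J m) ≤
      (p - 1) * finrank K (J.toSubmodule ⊓ monomialSpan K a v m : Submodule K L) +
        p * (p - 1 + m - 1).choose m := by
  refine (Submodule.finrank_add_le_finrank_add_finrank _ _).trans (add_le_add ?_ ?_)
  · refine (finrank_iSup_le_sum _).trans ((Finset.sum_le_card_nsmul _ _ _ fun i _ =>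
      Submodule.finrank_map_le _ _).trans ?_)
    rw [Finset.card_univ, ZMod.card_units, smul_eq_mul]
  · refine (finrank_iSup_le_sum _).trans ((Finset.sum_le_card_nsmul _ _ _ fun i _ =>
      (Submodule.finrank_map_le _ _).trans ((Submodule.finrank_map_le _ _).trans
        (F.finrank_fixed_monomialSpan_le ha m))).trans ?_)
    rw [Finset.card_univ, Fintype.card_fin, smul_eq_mul]

theorem recursionStep_le_monomialSpan (F : IsFrobeniusPair ω r a v f h)
    (H : IsGradedMetabelian K a v proj) {t : L} (ht : t ∈ Submodule.span K (Set.range a))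
    (J : LieIdeal K L) (m : ℕ) :
    recursionStep p a v f h t J m ≤ monomialSpan K a v (m + 1) :=
  recursionStep_le
    (fun i _ _ hx => lie_mem_monomialSpan H.lie_a v hx (Submodule.subset_span ⟨i, rfl⟩))
    (fun n _ _ hx _ => F.f_pow_mem_monomialSpan H.lie_a (lie_mem_monomialSpan H.lie_a v hx ht) n)

theorem f_mem_recursionStep (F : IsFrobeniusPair ω r a v f h) (H : IsGradedMetabelian K a v proj)
    {t : L} (ht : t ∈ Submodule.span K (Set.range a)) {J : LieIdeal K L} (hJ : ∀ x ∈ J, f x ∈ J)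
    {m : ℕ} {x : L} (hx : x ∈ recursionStep p a v f h t J m) :
    f x ∈ recursionStep p a v f h t J m := by
  refine recursionStep_le (P := (recursionStep p a v f h t J m).comap (f : L →ₗ[K] L)) ?_ ?_ hx
  · intro i x hx hx'
    rw [Submodule.mem_comap, LieHom.coe_toLinearMap, LieHom.map_lie, F.f_a, lie_smul]
    exact Submodule.smul_mem _ _
      (lie_a_mem_recursionStep f h t i (hJ x hx) (F.f_mem_monomialSpan H.lie_a hx'))
  · intro n hn x hx hx'
    rw [Submodule.mem_comap, ← Module.End.mul_apply, ← pow_succ']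
    rcases Nat.lt_or_ge (n + 1) p with hn' | hn'
    · exact pow_lie_mem_recursionStep f t J hn' hx hx'
    · rw [show n + 1 = p by omega, F.f_pow_p H.lie_a (lie_mem_monomialSpan H.lie_a v hx ht)]
      exact pow_lie_mem_recursionStep f t J (n := 0) (by omega) hx hx'

theorem h_mem_recursionStep (F : IsFrobeniusPair ω r a v f h) (H : IsGradedMetabelian K a v proj)
    {t : L} (ht : h t = t) {J : LieIdeal K L} (hJ : ∀ x ∈ J, h x ∈ J)
    {m : ℕ} {x : L} (hx : x ∈ recursionStep p a v f h t J m) :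
    h x ∈ recursionStep p a v f h t J m := by
  refine recursionStep_le (P := (recursionStep p a v f h t J m).comap (h : L →ₗ[K] L)) ?_ ?_ hx
  · intro i x hx hx'
    rw [Submodule.mem_comap, LieHom.coe_toLinearMap, LieHom.map_lie, F.h_a]
    exact lie_a_mem_recursionStep f h t _ (hJ x hx) (F.h_mem_monomialSpan H.lie_a hx')
  · intro n hn x hx hx'
    rw [Submodule.mem_comap, LieHom.coe_toLinearMap,
      F.h_f_pow H (m := ((n : ZMod p) * (r⁻¹ : (ZMod p)ˣ)).val) (by
        rw [ZMod.natCast_zmod_val, mul_assoc, ← Units.val_mul, inv_mul_cancel, Units.val_one,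
          mul_one]), LieHom.map_lie, hx', ht]
    exact pow_lie_mem_recursionStep f t J (ZMod.val_lt _) hx hx'

/-- The sum of the recursion steps contains every bracket of two `h`-fixed elements. -/
theorem lie_mem_iSup_recursionStep (F : IsFrobeniusPair ω r a v f h)
    (H : IsGradedMetabelian K a v proj) {t : L}
    (hgen : ∀ x ∈ Submodule.span K (Set.range a), h x = x → ∃ c : K, x = c • t)
    (J : LieIdeal K L) {x y : L} (hx : h x = x) (hy : h y = y) :
    ⁅x, y⁆ ∈ ⨆ m, recursionStep p a v f h t J m := by
  have decomp : ∀ z, h z = z → ∃ c : K, ∃ w ∈ ⨆ m, monomialSpan K a v m,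
      h w = w ∧ z = c • t + w := by
    intro z hz
    obtain ⟨h1, h2⟩ := H.proj_one_mem z
    have h3 : h (proj 1 z) = proj 1 z := by rw [← F.proj_h H, hz]
    obtain ⟨c, hc⟩ := hgen _ h1 h3
    exact ⟨c, _, h2, by rw [map_sub, hz, h3], by rw [← hc]; abel⟩
  have key : ∀ w ∈ ⨆ m, monomialSpan K a v m, h w = w →
      ⁅w, t⁆ ∈ ⨆ m, recursionStep p a v f h t J m := by
    intro w hw hhw
    obtain ⟨g, hg, rfl⟩ := (Submodule.mem_iSup_iff_exists_finsupp _ _).mp hw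
    have hproj : ∀ m, proj (m + 2) (g.sum fun _ u => u) = g m := by
      intro m
      rw [Finsupp.sum, map_sum, Finset.sum_congr rfl fun n _ => H.proj_of_mem_monomialSpan _ (hg n)]
      simp only [Nat.add_right_cancel_iff, Finset.sum_ite_eq]
      split_ifs with hm
      · rfl
      · simpa using (Finsupp.notMem_support_iff.mp hm).symm
    rw [Finsupp.sum, ← bracketRight_apply (K := K), map_sum]
    refine Submodule.sum_mem _ fun m _ => Submodule.mem_iSup_of_mem m ?_
    refine pow_lie_mem_recursionStep f t J (n := 0) (Fact.out : p.Prime).pos (hg m) ?_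
    rw [← hproj m, ← F.proj_h H, hhw]
  obtain ⟨c, u, hu, hhu, rfl⟩ := decomp x hx
  obtain ⟨d, w, hw, hhw, rfl⟩ := decomp y hy
  rw [add_lie, lie_add, lie_add, lie_eq_zero_of_mem_iSup H.lie_monomial hu hw,
    smul_lie, smul_lie, lie_smul, lie_smul,
    lie_self, ← lie_skew]
  simp only [smul_zero, zero_add, add_zero]
  exact add_mem (Submodule.smul_mem _ _ (neg_mem (key w hw hhw)))
    (Submodule.smul_mem _ _ (key u hu hhu))

theorem inf_monomialSpan_le (F : IsFrobeniusPair ω r a v f h) (H : IsGradedMetabelian K a v proj)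
    {t : L} (ht : t ∈ Submodule.span K (Set.range a)) (hht : h t = t)
    (hgen : ∀ x ∈ Submodule.span K (Set.range a), h x = x → ∃ c : K, x = c • t)
    {J : LieIdeal K L} (hJlie : ∀ x y, h x = x → h y = y → ⁅x, y⁆ ∈ J)
    (hJf : ∀ x ∈ J, f x ∈ J) (hJh : ∀ x ∈ J, h x ∈ J)
    (hJmin : ∀ I : LieIdeal K L, (∀ x y, h x = x → h y = y → ⁅x, y⁆ ∈ I) →
      (∀ x ∈ I, f x ∈ I) → (∀ x ∈ I, h x ∈ I) → J ≤ I) :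
    J.toSubmodule ⊓ monomialSpan K a v 0 = ⊥ ∧
      ∀ m, J.toSubmodule ⊓ monomialSpan K a v (m + 1) ≤ recursionStep p a v f h t J m := by
  have hle : ∀ m, recursionStep p a v f h t J m ≤ J.toSubmodule := by
    intro m
    refine recursionStep_le (fun i x hx _ => lie_mem_left K L J x (a i) hx) fun n _ x _ hx => ?_
    induction n with
    | zero => exact hJlie x t hx hht
    | succ n ih =>
      rw [pow_succ']
      exact hJf _ (ih (by omega))
  let I : LieIdeal K L :=
    { (⨆ m, recursionStep p a v f h t J m : Submodule K L) with
      lie_mem := by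
        intro y x hx
        change ⁅y, x⁆ ∈ ⨆ m, recursionStep p a v f h t J m
        refine (iSup_le fun m x hx => ?_ : ⨆ m, recursionStep p a v f h t J m ≤
          (⨆ m, recursionStep p a v f h t J m).comap (LieAlgebra.ad K L y)) hx
        rw [Submodule.mem_comap]
        change ⁅y, x⁆ ∈ _
        rw [← lie_skew, neg_mem_iff]
        have hx' := F.recursionStep_le_monomialSpan H ht J m hx
        have htop : (⊤ : Submodule K L) ≤ (⨆ m, recursionStep p a v f h t J m).comap
            (LieAlgebra.ad K L x) := by
          rw [← H.sup_eq_top, sup_le_iff, Submodule.span_le]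
          constructor
          · rintro _ ⟨i, rfl⟩
            exact Submodule.mem_iSup_of_mem (m + 1)
              (lie_a_mem_recursionStep f h t i (hle m hx) hx')
          · intro z hz
            rw [Submodule.mem_comap, LieAlgebra.ad_apply,
              lie_eq_zero_of_mem_iSup H.lie_monomial (Submodule.mem_iSup_of_mem _ hx') hz]
            exact zero_mem _
        exact htop Submodule.mem_top }
  have hJI : J.toSubmodule ≤ ⨆ m, recursionStep p a v f h t J m := by
    refine hJmin I (fun x y hx hy => F.lie_mem_iSup_recursionStep H hgen J hx hy) ?_ ?_
    · intro x hx
      exact (iSup_le fun m x hx => Submodule.mem_iSup_of_mem m (F.f_mem_recursionStep H ht hJf hx) :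
        ⨆ m, recursionStep p a v f h t J m ≤
          (⨆ m, recursionStep p a v f h t J m).comap (f : L →ₗ[K] L)) hx
    · intro x hx
      exact (iSup_le fun m x hx => Submodule.mem_iSup_of_mem m (F.h_mem_recursionStep H hht hJh hx) :
        ⨆ m, recursionStep p a v f h t J m ≤
          (⨆ m, recursionStep p a v f h t J m).comap (h : L →ₗ[K] L)) hx
  have hproj : ∀ n m, recursionStep p a v f h t J m ≤
      (if n = m + 1 then recursionStep p a v f h t J m else ⊥).comap (proj (n + 2)) := by
    intro n m x hx
    rw [Submodule.mem_comap,
      H.proj_of_mem_monomialSpan _ (F.recursionStep_le_monomialSpan H ht J m hx)]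
    split_ifs <;> simp_all
  have hself : ∀ n, ∀ x ∈ monomialSpan K a v n, proj (n + 2) x = x := by
    intro n x hx
    simp [H.proj_of_mem_monomialSpan _ hx]
  constructor
  · rw [eq_bot_iff]
    rintro x ⟨hx, hx'⟩
    have := (iSup_le fun m => (hproj 0 m).trans (Submodule.comap_mono (by simp)) :
      ⨆ m, recursionStep p a v f h t J m ≤ (⊥ : Submodule K L).comap (proj 2)) (hJI hx)
    rwa [Submodule.mem_comap, hself 0 x hx'] at this
  · rintro n x ⟨hx, hx'⟩
    have := (iSup_le fun m => (hproj (n + 1) m).trans (Submodule.comap_mono (by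
      split_ifs with hm
      · rw [show m = n by omega]
      · exact bot_le)) :
      ⨆ m, recursionStep p a v f h t J m ≤
        (recursionStep p a v f h t J n).comap (proj (n + 1 + 2))) (hJI hx)
    rwa [Submodule.mem_comap, hself (n + 1) x hx'] at this

theorem finrank_inf_monomialSpan_le (F : IsFrobeniusPair ω r a v f h)
    (H : IsGradedMetabelian K a v proj)
    {J : LieIdeal K L} (hJlie : ∀ x y, h x = x → h y = y → ⁅x, y⁆ ∈ J)
    (hJf : ∀ x ∈ J, f x ∈ J) (hJh : ∀ x ∈ J, h x ∈ J)
    (hJmin : ∀ I : LieIdeal K L, (∀ x y, h x = x → h y = y → ⁅x, y⁆ ∈ I) →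
      (∀ x ∈ I, f x ∈ I) → (∀ x ∈ I, h x ∈ I) → J ≤ I) :
    (∀ m, finrank K (J.toSubmodule ⊓ monomialSpan K a v (m + 1) : Submodule K L) ≤
      (p - 1) * finrank K (J.toSubmodule ⊓ monomialSpan K a v m : Submodule K L) +
        p * (p - 1 + m - 1).choose m) ∧
    finrank K (J.toSubmodule ⊓ monomialSpan K a v 1 : Submodule K L) ≤ p := by
  obtain ⟨t, ht, hht, hgen⟩ := F.exists_fixed_generator
  obtain ⟨h0, hm⟩ := F.inf_monomialSpan_le H ht hht hgen hJlie hJf hJh hJmin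
  have key : ∀ m, finrank K (J.toSubmodule ⊓ monomialSpan K a v (m + 1) : Submodule K L) ≤
      (p - 1) * finrank K (J.toSubmodule ⊓ monomialSpan K a v m : Submodule K L) +
        p * (p - 1 + m - 1).choose m := by
    intro m
    have : FiniteDimensional K (recursionStep p a v f h t J m) :=
      Submodule.finiteDimensional_of_le (F.recursionStep_le_monomialSpan H ht J m)
    exact (Submodule.finrank_mono (hm m)).trans (F.finrank_recursionStep_le H.lie_a t J m)
  refine ⟨key, ?_⟩
  have := key 0
  rw [h0, finrank_bot] at this
  simpa using this

end IsFrobeniusPair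

end Recursion

section Presentation

open scoped TensorProduct

/-- The projection from the free Lie algebra onto its quotient `Lp`. -/
noncomputable def mkHom : FreeLieAlgebra K (Idx p) →ₗ⁅K⁆ Lp K p :=
  { (relIdeal K p).toSubmodule.mkQ with
    map_lie' := fun {x y} => LieSubmodule.Quotient.mk_bracket (I := relIdeal K p) x y }

theorem mkHom_surjective : Function.Surjective (mkHom K p) :=
  Submodule.mkQ_surjective _

theorem mkHom_of (x : Idx p) : mkHom K p (FreeLieAlgebra.of K x) = gen K p x := rfl

theorem mkHom_eq_zero {z : FreeLieAlgebra K (Idx p)} (hz : z ∈ relIdeal K p) :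
    mkHom K p z = 0 :=
  (Submodule.Quotient.mk_eq_zero _).mpr hz

theorem lie_aGen_aGen (i j : (ZMod p)ˣ) : ⁅aGen K p i, aGen K p j⁆ = 0 := by
  have h := mkHom_eq_zero K p (LieSubmodule.subset_lieSpan (Or.inl ⟨i, j, rfl⟩))
  rwa [LieHom.map_lie] at h

/-- The image in `Lp` of the ideal generated by the `v`-generators. -/
noncomputable def vIdealImage : Submodule K (Lp K p) :=
  (vIdealFree K p).toSubmodule.map (mkHom K p : FreeLieAlgebra K (Idx p) →ₗ[K] Lp K p)

theorem vGen_mem_vIdealImage (i : (ZMod p)ˣ) : vGen K p i ∈ vIdealImage K p :=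
  ⟨_, LieSubmodule.subset_lieSpan ⟨i, rfl⟩, rfl⟩

theorem lie_mem_vIdealImage {x : Lp K p} (hx : x ∈ vIdealImage K p) (y : Lp K p) :
    ⁅y, x⁆ ∈ vIdealImage K p := by
  obtain ⟨u, hu, rfl⟩ := hx
  obtain ⟨w, rfl⟩ := mkHom_surjective K p y
  exact ⟨⁅w, u⁆, (vIdealFree K p).lie_mem hu, LieHom.map_lie _ _ _⟩

theorem lie_eq_zero_of_mem_vIdealImage {x y : Lp K p} (hx : x ∈ vIdealImage K p)
    (hy : y ∈ vIdealImage K p) : ⁅x, y⁆ = 0 := by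
  obtain ⟨u, hu, rfl⟩ := hx
  obtain ⟨w, hw, rfl⟩ := hy
  have h := mkHom_eq_zero K p (LieSubmodule.subset_lieSpan (Or.inr ⟨u, hu, w, hw, rfl⟩))
  rwa [LieHom.map_lie] at h

theorem adMonomial_mem_vIdealImage (s : Multiset (ZMod p)ˣ) (j : (ZMod p)ˣ) :
    adMonomial (aGen K p) s (vGen K p j) ∈ vIdealImage K p := by
  induction s using Multiset.induction_on with
  | empty => simpa using vGen_mem_vIdealImage K p j
  | cons i s ih =>
    rw [adMonomial_cons (lie_aGen_aGen K p), ← lie_skew]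
    exact neg_mem (lie_mem_vIdealImage K p ih _)

theorem mem_of_gen_mem (S : LieSubalgebra K (Lp K p)) (ha : ∀ i, aGen K p i ∈ S)
    (hv : ∀ i, vGen K p i ∈ S) (y : Lp K p) : y ∈ S := by
  have hS : ∀ x : Idx p, gen K p x ∈ S := by
    rintro (i | i)
    exacts [ha i, hv i]
  have e : S.incl.comp (FreeLieAlgebra.lift K fun x => (⟨gen K p x, hS x⟩ : S)) = mkHom K p := by
    refine FreeLieAlgebra.hom_ext fun x => ?_
    rw [LieHom.comp_apply, FreeLieAlgebra.lift_of_apply, mkHom_of]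
    rfl
  obtain ⟨z, rfl⟩ := mkHom_surjective K p y
  rw [← e]
  exact Subtype.property _

/-- A homomorphism from the free Lie algebra killing the relations factors through `Lp`. -/
theorem exists_lift {L' : Type*} [LieRing L'] [LieAlgebra K L']
    (F : FreeLieAlgebra K (Idx p) →ₗ⁅K⁆ L') (hF : ∀ z ∈ rels K p, F z = 0) :
    ∃ Φ : Lp K p →ₗ⁅K⁆ L', ∀ z, Φ (mkHom K p z) = F z := by
  have hle : relIdeal K p ≤ F.ker :=
    LieSubmodule.lieSpan_le.mpr fun z hz => LieHom.mem_ker.mpr (hF z hz)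
  let Φ : Lp K p →ₗ[K] L' := (relIdeal K p).toSubmodule.liftQ
    (F : FreeLieAlgebra K (Idx p) →ₗ[K] L')
    fun z hz => LieHom.mem_ker.mp (hle hz)
  have hΦ : ∀ z, Φ (mkHom K p z) = F z := fun z => rfl
  refine ⟨{ Φ with map_lie' := ?_ }, hΦ⟩
  intro x y
  obtain ⟨u, rfl⟩ := mkHom_surjective K p x
  obtain ⟨w, rfl⟩ := mkHom_surjective K p y
  change Φ _ = ⁅Φ _, Φ _⁆
  rw [← LieHom.map_lie, hΦ, hΦ, hΦ, LieHom.map_lie]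

theorem lie_mem_of_mem_span {R L : Type*} [CommRing R] [LieRing L] [LieAlgebra R L] {s t : Set L}
    {N : Submodule R L} (h : ∀ z ∈ s, ∀ w ∈ t, ⁅z, w⁆ ∈ N) {z w : L}
    (hz : z ∈ Submodule.span R s) (hw : w ∈ Submodule.span R t) : ⁅z, w⁆ ∈ N := by
  induction hz using Submodule.span_induction with
  | mem z hz =>
    induction hw using Submodule.span_induction with
    | mem w hw => exact h z hz w hw
    | zero => simp
    | add w w' _ _ hw hw' => rw [lie_add]; exact add_mem hw hw'
    | smul c w _ hw => rw [lie_smul]; exact N.smul_mem _ hw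
  | zero => simp
  | add z z' _ _ hz hz' => rw [add_lie]; exact add_mem hz hz'
  | smul c z _ hz => rw [smul_lie]; exact N.smul_mem _ hz

/-- The coaction recording a weight on the generators. -/
theorem exists_coaction (wt : Idx p → ℕ) :
    ∃ Φ : Lp K p →ₗ⁅K⁆ LieAlgebra.loopAlgebra K ℕ (Lp K p),
      ∀ x, Φ (gen K p x) = AddMonoidAlgebra.single (wt x) 1 ⊗ₜ[K] gen K p x := by
  let F : FreeLieAlgebra K (Idx p) →ₗ⁅K⁆ LieAlgebra.loopAlgebra K ℕ (Lp K p) :=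
    FreeLieAlgebra.lift K fun x => AddMonoidAlgebra.single (wt x) 1 ⊗ₜ[K] gen K p x
  have hF : ∀ x, F (FreeLieAlgebra.of K x) = AddMonoidAlgebra.single (wt x) 1 ⊗ₜ[K] gen K p x :=
    fun x => FreeLieAlgebra.lift_of_apply (R := K) _ x
  let T : Submodule K (LieAlgebra.loopAlgebra K ℕ (Lp K p)) :=
    Submodule.span K {z | ∃ g : AddMonoidAlgebra K ℕ, ∃ x ∈ vIdealImage K p, z = g ⊗ₜ[K] x}
  have hT : ∀ z : LieAlgebra.loopAlgebra K ℕ (Lp K p), ∀ w ∈ T, ⁅z, w⁆ ∈ T := by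
    intro z w hw
    have hz : z ∈ Submodule.span K
        {z : LieAlgebra.loopAlgebra K ℕ (Lp K p) | ∃ g y, g ⊗ₜ[K] y = z} :=
      (TensorProduct.span_tmul_eq_top K (AddMonoidAlgebra K ℕ) (Lp K p)).ge trivial
    refine lie_mem_of_mem_span ?_ hz hw
    rintro _ ⟨g', y, rfl⟩ _ ⟨g, x, hx, rfl⟩
    refine Set.mem_of_eq_of_mem (LieAlgebra.ExtendScalars.bracket_tmul K _ _ _ g' g y x) ?_
    exact Submodule.subset_span ⟨_, _, lie_mem_vIdealImage K p hx y, rfl⟩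
  have hTT : ∀ z ∈ T, ∀ w ∈ T, ⁅z, w⁆ = 0 := by
    intro z hz w hw
    refine (Submodule.mem_bot K).mp (lie_mem_of_mem_span ?_ hz hw)
    rintro _ ⟨g', y, hy, rfl⟩ _ ⟨g, x, hx, rfl⟩
    refine (Submodule.mem_bot K).mpr
      ((LieAlgebra.ExtendScalars.bracket_tmul K _ _ _ g' g y x).trans ?_)
    rw [lie_eq_zero_of_mem_vIdealImage K p hy hx, TensorProduct.tmul_zero]
  let I : LieIdeal K (FreeLieAlgebra K (Idx p)) :=
    { T.comap (F : FreeLieAlgebra K (Idx p) →ₗ[K] LieAlgebra.loopAlgebra K ℕ (Lp K p)) with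
      lie_mem := by
        intro z w hw
        change F ⁅z, w⁆ ∈ T
        rw [LieHom.map_lie]
        exact hT _ _ hw }
  have hI : vIdealFree K p ≤ I := by
    refine LieSubmodule.lieSpan_le.mpr ?_
    rintro _ ⟨i, rfl⟩
    change F _ ∈ T
    rw [hF]
    exact Submodule.subset_span ⟨_, _, vGen_mem_vIdealImage K p i, rfl⟩
  obtain ⟨Φ, hΦ⟩ := exists_lift K p F (by
    rintro _ (⟨i, j, rfl⟩ | ⟨u, hu, w, hw, rfl⟩)
    · rw [LieHom.map_lie, hF, hF, LieAlgebra.ExtendScalars.bracket_tmul]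
      exact (congrArg _ (lie_aGen_aGen K p i j)).trans (TensorProduct.tmul_zero _ _)
    · rw [LieHom.map_lie]
      exact hTT _ (hI hu) _ (hI hw))
  exact ⟨Φ, fun x => (hΦ (FreeLieAlgebra.of K x)).trans (hF x)⟩

theorem exists_isGradedMetabelian :
    ∃ proj, IsGradedMetabelian K (aGen K p) (vGen K p) proj := by
  obtain ⟨Φ, hΦ⟩ := exists_coaction K p (Sum.elim (fun _ => 1) fun _ => 2)
  have ha : ∀ i, Φ (aGen K p i) = AddMonoidAlgebra.single 1 1 ⊗ₜ[K] aGen K p i :=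
    fun i => hΦ (Sum.inl i)
  have hm : ∀ s j, Φ (adMonomial (aGen K p) s (vGen K p j)) =
      AddMonoidAlgebra.single (s.card + 2) 1 ⊗ₜ[K] adMonomial (aGen K p) s (vGen K p j) := by
    intro s j
    induction s using Multiset.induction_on with
    | empty => rw [adMonomial_zero]; exact hΦ (Sum.inr j)
    | cons i s ih =>
      rw [adMonomial_cons (lie_aGen_aGen K p), LieHom.map_lie, ih, ha,
        LieAlgebra.ExtendScalars.bracket_tmul, AddMonoidAlgebra.single_mul_single, mul_one,
        Multiset.card_cons, add_right_comm]
  have hv : ∀ s i t j, ⁅adMonomial (aGen K p) s (vGen K p i),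
      adMonomial (aGen K p) t (vGen K p j)⁆ = 0 := fun s i t j =>
    lie_eq_zero_of_mem_vIdealImage K p (adMonomial_mem_vIdealImage K p s i)
      (adMonomial_mem_vIdealImage K p t j)
  refine ⟨fun n => Finsupp.lapply n ∘ₗ
    (LieAlgebra.LoopAlgebra.toFinsupp K ℕ (Lp K p)).toLinearMap ∘ₗ (Φ : Lp K p →ₗ[K] _),
    lie_aGen_aGen K p, hv,
    span_sup_iSup_monomialSpan_eq_top (lie_aGen_aGen K p) hv (mem_of_gen_mem K p), ?_, ?_⟩
  · intro n i
    simp only [LinearMap.comp_apply, LieHom.coe_toLinearMap, LinearEquiv.coe_coe, ha,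
      LieAlgebra.LoopAlgebra.toFinsupp_single_tmul, Finsupp.lapply_apply, Finsupp.single_apply,
      eq_comm]
  · intro n s i
    simp only [LinearMap.comp_apply, LieHom.coe_toLinearMap, LinearEquiv.coe_coe, hm,
      LieAlgebra.LoopAlgebra.toFinsupp_single_tmul, Finsupp.lapply_apply, Finsupp.single_apply,
      eq_comm]

theorem lnb_concat (x : Idx p) (l : List (Idx p)) (y : Idx p) :
    lnb K p x (l ++ [y]) = ⁅lnb K p x l, gen K p y⁆ := by
  simp [lnb]

theorem monomialSpan_le_homog (m : ℕ) :
    monomialSpan K (aGen K p) (vGen K p) m ≤ homog K p (m + 1) := by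
  have key : ∀ (s : Multiset (ZMod p)ˣ) (j : (ZMod p)ˣ), ∃ l : List (Idx p), l.length = s.card ∧
      adMonomial (aGen K p) s (vGen K p j) = lnb K p (Sum.inr j) l := by
    intro s j
    induction s using Multiset.induction_on with
    | empty => exact ⟨[], rfl, by rw [adMonomial_zero]; rfl⟩
    | cons i s ih =>
      obtain ⟨l, hl, hs⟩ := ih
      refine ⟨l ++ [Sum.inl i], by simp [hl], ?_⟩
      rw [adMonomial_cons (lie_aGen_aGen K p), hs, lnb_concat]
      rfl
  refine monomialSpan_le ?_
  rintro s j rfl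
  obtain ⟨l, hl, hs⟩ := key s j
  exact Submodule.subset_span ⟨_, l, by rw [hl], hs⟩

theorem homog_eq_monomialSpan (m : ℕ) :
    homog K p (m + 2) = monomialSpan K (aGen K p) (vGen K p) (m + 1) := by
  obtain ⟨proj, H⟩ := exists_isGradedMetabelian K p
  refine le_antisymm ?_ (monomialSpan_le_homog K p (m + 1))
  have hv : ∀ j, vGen K p j ∈ monomialSpan K (aGen K p) (vGen K p) 0 := fun j => by
    simpa using adMonomial_mem_monomialSpan (K := K) (aGen K p) (vGen K p) 0 j
  have ha : ∀ j, aGen K p j ∈ Submodule.span K (Set.range (aGen K p)) := fun j =>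
    Submodule.subset_span ⟨j, rfl⟩
  have hmul : ∀ n, ∀ z ∈ monomialSpan K (aGen K p) (vGen K p) n, ∀ y,
      ⁅z, gen K p y⁆ ∈ monomialSpan K (aGen K p) (vGen K p) (n + 1) := by
    rintro n z hz (i | i)
    · exact lie_mem_monomialSpan H.lie_a _ hz (ha i)
    · have : ⁅z, vGen K p i⁆ = 0 := lie_eq_zero_of_mem_iSup H.lie_monomial
        (Submodule.mem_iSup_of_mem n hz) (Submodule.mem_iSup_of_mem 0 (hv i))
      exact this ▸ zero_mem _
  have htwo : ∀ x y : Idx p,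
      ⁅gen K p x, gen K p y⁆ ∈ monomialSpan K (aGen K p) (vGen K p) 1 := by
    rintro (i | i) y
    · rcases y with j | j
      · exact (lie_aGen_aGen K p i j).symm ▸ zero_mem _
      · rw [← lie_skew]
        exact neg_mem (hmul 0 _ (hv j) (Sum.inl i))
    · exact hmul 0 _ (hv i) y
  have key : ∀ (x : Idx p) (l : List (Idx p)), l ≠ [] →
      lnb K p x l ∈ monomialSpan K (aGen K p) (vGen K p) l.length := by
    intro x l
    induction l using List.reverseRecOn with
    | nil => simp
    | append_singleton l y ih =>
      intro _
      rw [lnb_concat]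
      rcases eq_or_ne l [] with rfl | hl
      · exact htwo x y
      · rw [List.length_append]
        exact hmul _ _ (ih hl) y
  rw [homog, Submodule.span_le]
  rintro _ ⟨x, l, hl, rfl⟩
  have hl' : l.length = m + 1 := by omega
  rw [← hl']
  exact key x l (by rintro rfl; simp at hl')

end Presentation

section Jp

variable {K p} {f h : Lp K p ≃ₗ⁅K⁆ Lp K p}

theorem mem_Jp {x : Lp K p} : x ∈ Jp K p f h ↔ ∀ J : LieIdeal K (Lp K p),
    (∀ z ∈ derivedFixed K p h, z ∈ J) → (∀ x ∈ J, f x ∈ J) → (∀ x ∈ J, h x ∈ J) → x ∈ J := by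
  rw [Jp, ← SetLike.mem_coe, LieSubmodule.coe_sInf]
  simp

theorem lie_mem_Jp {x y : Lp K p} (hx : h x = x) (hy : h y = y) : ⁅x, y⁆ ∈ Jp K p f h :=
  mem_Jp.mpr fun _ hJ _ _ => hJ _ (LieSubalgebra.subset_lieSpan ⟨x, hx, y, hy, rfl⟩)

theorem f_mem_Jp {x : Lp K p} (hx : x ∈ Jp K p f h) : f x ∈ Jp K p f h :=
  mem_Jp.mpr fun J hJ hf hh => hf _ (mem_Jp.mp hx J hJ hf hh)

theorem h_mem_Jp {x : Lp K p} (hx : x ∈ Jp K p f h) : h x ∈ Jp K p f h :=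
  mem_Jp.mpr fun J hJ hf hh => hh _ (mem_Jp.mp hx J hJ hf hh)

theorem Jp_le {I : LieIdeal K (Lp K p)} (hI : ∀ x y, h x = x → h y = y → ⁅x, y⁆ ∈ I)
    (hf : ∀ x ∈ I, f x ∈ I) (hh : ∀ x ∈ I, h x ∈ I) : Jp K p f h ≤ I := by
  intro x hx
  refine mem_Jp.mp hx I (fun z hz => ?_) hf hh
  have hle : derivedFixed K p h ≤ LieIdeal.toLieSubalgebra K (Lp K p) I := by
    refine LieSubalgebra.lieSpan_le.mpr ?_
    rintro _ ⟨x, hx, y, hy, rfl⟩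
    exact hI x y hx hy
  exact hle hz

end Jp

/-- **The recursion for `J_p`.**  For every `k ≥ 3`,
`dim (J_p ∩ L_{p,k}) ≤ (p−1) · dim (J_p ∩ L_{p,k−1}) + p · C(k+p−4, k−2)`, and
`dim (J_p ∩ L_{p,2}) ≤ p`. -/
theorem rank_Jp_inter_homog_recursion (K : Type) [Field K] (p : ℕ) [Fact p.Prime]
    (hchar : ¬ (ringChar K ∣ p)) (ω : K) (hω : IsPrimitiveRoot ω p)
    (r : (ZMod p)ˣ) (hr : Subgroup.zpowers r = ⊤)
    (f h : Lp K p ≃ₗ⁅K⁆ Lp K p)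
    (hfa : ∀ i : (ZMod p)ˣ, f (aGen K p i) = ω ^ ((i : ZMod p)).val • aGen K p i)
    (hfv : ∀ i : (ZMod p)ˣ, f (vGen K p i) = ω ^ ((i : ZMod p)).val • vGen K p i)
    (hha : ∀ i : (ZMod p)ˣ, h (aGen K p i) = aGen K p (r * i))
    (hhv : ∀ i : (ZMod p)ˣ, h (vGen K p i) = vGen K p (r * i)) :
    (∀ k : ℕ, 3 ≤ k →
      Module.rank K ((Jp K p f h).toSubmodule ⊓ homog K p k : Submodule K (Lp K p))
        ≤ ((p - 1 : ℕ) : Cardinal) *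
            Module.rank K ((Jp K p f h).toSubmodule ⊓ homog K p (k - 1) : Submodule K (Lp K p))
          + ((p * Nat.choose (k + p - 4) (k - 2) : ℕ) : Cardinal)) ∧
    Module.rank K ((Jp K p f h).toSubmodule ⊓ homog K p 2 : Submodule K (Lp K p))
      ≤ ((p : ℕ) : Cardinal) := by
  obtain ⟨proj, H⟩ := exists_isGradedMetabelian K p
  have F : IsFrobeniusPair ω r (aGen K p) (vGen K p) (f : Lp K p →ₗ⁅K⁆ Lp K p)
      (h : Lp K p →ₗ⁅K⁆ Lp K p) := ⟨hω.pow_eq_one, hr, hfa, hfv, hha, hhv⟩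
  obtain ⟨h1, h2⟩ := F.finrank_inf_monomialSpan_le H (J := Jp K p f h)
    (fun _ _ hx hy => lie_mem_Jp hx hy) (fun _ hx => f_mem_Jp hx) (fun _ hx => h_mem_Jp hx)
    (fun _ => Jp_le)
  refine ⟨fun k hk => ?_, ?_⟩
  · obtain ⟨m, rfl⟩ := Nat.exists_eq_add_of_le hk
    rw [show 3 + m = m + 1 + 2 by ring, show m + 1 + 2 - 1 = m + 2 by omega, homog_eq_monomialSpan,
      homog_eq_monomialSpan, ← Module.finrank_eq_rank, ← Module.finrank_eq_rank,
      show m + 1 + 2 + p - 4 = p - 1 + (m + 1) - 1 by have := (Fact.out : p.Prime).pos; omega]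
    exact_mod_cast h1 (m + 1)
  · rw [homog_eq_monomialSpan K p 0, ← Module.finrank_eq_rank]
    exact_mod_cast h2

end Paper
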